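/- (Weighted-L² inner product formula, Eq. (E47).) For x ∈ ℝ^d define F_x : ℝ^d → ℂ by F_x(t) = (4πσ)^{−d/2} · { exp(−i xᵀt − ‖t‖²/(4σ)) − exp(−i m₀ᵀt − tᵀVt/(4σ)) · ( 1 − i tᵀ(x−m₀) − (1/2) tᵀB(x)t ) }. Then for all x, y ∈ ℝ^d, (4πσ)^{d/2} ∫_{ℝ^d} F_x(t) · conj(F_y(t)) · exp(‖t‖²/(4σ)) dt = K(x,y); in particular the integral is real. -/

import Mathlib

open MeasureTheory Matrix Real

/-- The Gaussian probability measure `N(m, Σ)` on `ℝ^d`, given by its density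
`(2π)^{-d/2} det(Σ)^{-1/2} exp(-(x-m)ᵀ Σ⁻¹ (x-m) / 2)` with respect to Lebesgue measure. -/
noncomputable def gaussN {d : ℕ} (m : Fin d → ℝ) (S : Matrix (Fin d) (Fin d) ℝ) :
    Measure (Fin d → ℝ) :=
  MeasureTheory.volume.withDensity fun x =>
    ENNReal.ofReal ((2 * π) ^ (-(d : ℝ) / 2) * S.det ^ (-(1 : ℝ) / 2) *
      Real.exp (-((x - m) ⬝ᵥ (S⁻¹ *ᵥ (x - m))) / 2))

/-- `V = I_d + 2σΣ₀`. -/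
noncomputable def Vm {d : ℕ} (σ : ℝ) (S : Matrix (Fin d) (Fin d) ℝ) :
    Matrix (Fin d) (Fin d) ℝ :=
  1 + (2 * σ) • S

/-- `B(x) = (x−m₀)(x−m₀)ᵀ − Σ₀`. -/
noncomputable def Bm {d : ℕ} (m₀ : Fin d → ℝ) (S : Matrix (Fin d) (Fin d) ℝ)
    (x : Fin d → ℝ) : Matrix (Fin d) (Fin d) ℝ :=
  vecMulVec (x - m₀) (x - m₀) - S

/-- `T₁(x,y) = exp(−σ‖x−y‖²)`. -/
noncomputable def T1 {d : ℕ} (σ : ℝ) (x y : Fin d → ℝ) : ℝ :=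
  Real.exp (-σ * ((x - y) ⬝ᵥ (x - y)))

/-- `T₂(x,y) = det(V)^{−1/2} exp(−σ(x−m₀)ᵀV⁻¹(x−m₀)) ·
(1 + 2σ(x−m₀)ᵀV⁻¹(y−m₀) + σ tr[V⁻¹(2σ(B(x)+Σ₀)V⁻¹ − I_d)B(y)])`. -/
noncomputable def T2 {d : ℕ} (σ : ℝ) (m₀ : Fin d → ℝ) (S : Matrix (Fin d) (Fin d) ℝ)
    (x y : Fin d → ℝ) : ℝ :=
  (Vm σ S).det ^ (-(1 : ℝ) / 2) *
    Real.exp (-σ * ((x - m₀) ⬝ᵥ ((Vm σ S)⁻¹ *ᵥ (x - m₀)))) *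
    (1 + 2 * σ * ((x - m₀) ⬝ᵥ ((Vm σ S)⁻¹ *ᵥ (y - m₀))) +
      σ * ((Vm σ S)⁻¹ * ((2 * σ) • (Bm m₀ S x + S) * (Vm σ S)⁻¹ - 1) * Bm m₀ S y).trace)

/-- `T₃(x,y) = T₂(y,x)`. -/
noncomputable def T3 {d : ℕ} (σ : ℝ) (m₀ : Fin d → ℝ) (S : Matrix (Fin d) (Fin d) ℝ)
    (x y : Fin d → ℝ) : ℝ :=
  T2 σ m₀ S y x

/-- `T₄(x,y) = det(2V−I_d)^{−1/2} · (1 + σ tr[(2(x−m₀)(y−m₀)ᵀ − B(x) − B(y))(2V−I_d)⁻¹]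
+ σ²(tr[B(x)(2V−I_d)⁻¹]·tr[B(y)(2V−I_d)⁻¹] + 2 tr[B(x)(2V−I_d)⁻¹B(y)(2V−I_d)⁻¹]))`. -/
noncomputable def T4 {d : ℕ} (σ : ℝ) (m₀ : Fin d → ℝ) (S : Matrix (Fin d) (Fin d) ℝ)
    (x y : Fin d → ℝ) : ℝ :=
  ((2 : ℝ) • Vm σ S - 1).det ^ (-(1 : ℝ) / 2) *
    (1 + σ * (((2 : ℝ) • vecMulVec (x - m₀) (y - m₀) - Bm m₀ S x - Bm m₀ S y) *
        ((2 : ℝ) • Vm σ S - 1)⁻¹).trace +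
      σ ^ 2 * ((Bm m₀ S x * ((2 : ℝ) • Vm σ S - 1)⁻¹).trace *
          (Bm m₀ S y * ((2 : ℝ) • Vm σ S - 1)⁻¹).trace +
        2 * (Bm m₀ S x * ((2 : ℝ) • Vm σ S - 1)⁻¹ *
          Bm m₀ S y * ((2 : ℝ) • Vm σ S - 1)⁻¹).trace))

/-- `K(x,y) = T₁(x,y) − T₂(x,y) − T₃(x,y) + T₄(x,y)`. -/
noncomputable def Kf {d : ℕ} (σ : ℝ) (m₀ : Fin d → ℝ) (S : Matrix (Fin d) (Fin d) ℝ)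
    (x y : Fin d → ℝ) : ℝ :=
  T1 σ x y - T2 σ m₀ S x y - T3 σ m₀ S x y + T4 σ m₀ S x y

/-- `F_x(t) = (4πσ)^{−d/2} ( exp(−i xᵀt − ‖t‖²/(4σ)) −
exp(−i m₀ᵀt − tᵀVt/(4σ)) (1 − i tᵀ(x−m₀) − (1/2) tᵀB(x)t) )`. -/
noncomputable def Ff {d : ℕ} (σ : ℝ) (m₀ : Fin d → ℝ) (S : Matrix (Fin d) (Fin d) ℝ)
    (x t : Fin d → ℝ) : ℂ :=
  (((4 * π * σ) ^ (-(d : ℝ) / 2) : ℝ) : ℂ) *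
    (Complex.exp (-Complex.I * ((x ⬝ᵥ t : ℝ) : ℂ) - ((t ⬝ᵥ t : ℝ) : ℂ) / (4 * (σ : ℂ))) -
      Complex.exp (-Complex.I * ((m₀ ⬝ᵥ t : ℝ) : ℂ) -
          ((t ⬝ᵥ (Vm σ S *ᵥ t) : ℝ) : ℂ) / (4 * (σ : ℂ))) *
        (1 - Complex.I * ((t ⬝ᵥ (x - m₀) : ℝ) : ℂ) -
          (1 / 2) * ((t ⬝ᵥ (Bm m₀ S x *ᵥ t) : ℝ) : ℂ)))

/-- The Gaussian weight `exp(wᵀt − tᵀAt/(4σ))` with complex drift `w`. -/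
noncomputable def gaussWeight {d : ℕ} (σ : ℝ) (A : Matrix (Fin d) (Fin d) ℝ) (w : Fin d → ℂ)
    (t : Fin d → ℝ) : ℂ :=
  Complex.exp (∑ i, w i * (t i : ℂ) - ((t ⬝ᵥ (A *ᵥ t) : ℝ) : ℂ) / (4 * (σ : ℂ)))

section GaussWeight

variable {d : ℕ} {σ : ℝ} {A : Matrix (Fin d) (Fin d) ℝ}

theorem Matrix.PosDef.exists_eq_transpose_mul_self (hA : A.PosDef) :
    ∃ N : Matrix (Fin d) (Fin d) ℝ, A = Nᵀ * N ∧ N.det ≠ 0 := by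
  open scoped MatrixOrder Matrix.Norms.L2Operator in
  obtain ⟨N, hN⟩ := CStarAlgebra.nonneg_iff_eq_star_mul_self.mp hA.posSemidef.nonneg
  rw [star_eq_conjTranspose, conjTranspose_eq_transpose_of_trivial] at hN
  refine ⟨N, hN, fun h => hA.det_pos.ne' ?_⟩
  rw [hN, det_mul, h, mul_zero]

theorem measurableEmbedding_mulVec {N : Matrix (Fin d) (Fin d) ℝ} (hN : N.det ≠ 0) :
    MeasurableEmbedding (toLin' N) :=
  (toLin' N).continuous_of_finiteDimensional.measurableEmbedding <|
    mulVec_injective_iff_isUnit.mpr ((isUnit_iff_isUnit_det N).mpr hN.isUnit)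

theorem integrable_comp_mulVec {N : Matrix (Fin d) (Fin d) ℝ} (hN : N.det ≠ 0)
    {h : (Fin d → ℝ) → ℂ} (hh : Integrable h) : Integrable (fun t => h (N *ᵥ t)) := by
  have := (measurableEmbedding_mulVec hN).integrable_map_iff (μ := volume) (g := h)
  rw [Real.map_matrix_volume_pi_eq_smul_volume_pi hN] at this
  exact this.mp (hh.smul_measure ENNReal.ofReal_ne_top)

theorem integral_comp_mulVec {N : Matrix (Fin d) (Fin d) ℝ} (hN : N.det ≠ 0)
    (h : (Fin d → ℝ) → ℂ) : ∫ t, h (N *ᵥ t) = ((|N.det|⁻¹ : ℝ) : ℂ) * ∫ t, h t := by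
  have := (measurableEmbedding_mulVec hN).integral_map (μ := volume) h
  rw [Real.map_matrix_volume_pi_eq_smul_volume_pi hN, integral_smul_measure,
    ENNReal.toReal_ofReal (abs_nonneg _), abs_inv, Complex.real_smul] at this
  exact this.symm

theorem gaussWeight_one (w : Fin d → ℂ) :
    gaussWeight σ 1 w = fun s : Fin d → ℝ =>
      Complex.exp (-(1 / (4 * (σ : ℂ))) * ∑ i, (s i : ℂ) ^ 2 + ∑ i, w i * s i) := by
  ext s
  simp only [gaussWeight, one_mulVec, dotProduct, Complex.ofReal_sum, Complex.ofReal_mul, sq]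
  congr 1
  ring

theorem gaussWeight_transpose_mul_self (N : Matrix (Fin d) (Fin d) ℝ) (hN : N.det ≠ 0)
    (w : Fin d → ℂ) (t : Fin d → ℝ) :
    gaussWeight σ (Nᵀ * N) w t =
      gaussWeight σ 1 (w ᵥ* (N⁻¹).map Complex.ofReal) (N *ᵥ t) := by
  have h1 : t ⬝ᵥ ((Nᵀ * N) *ᵥ t) = (N *ᵥ t) ⬝ᵥ (N *ᵥ t) := by
    rw [← mulVec_mulVec, dotProduct_mulVec, vecMul_transpose]
  have h2 : ∑ i, (w ᵥ* (N⁻¹).map Complex.ofReal) i * ((N *ᵥ t) i : ℂ) = ∑ i, w i * (t i : ℂ) := by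
    change (w ᵥ* (N⁻¹).map Complex.ofRealHom) ⬝ᵥ (Complex.ofRealHom ∘ (N *ᵥ t)) =
      w ⬝ᵥ (Complex.ofRealHom ∘ t)
    rw [← dotProduct_mulVec]
    congr 1
    ext i
    rw [← RingHom.map_mulVec, mulVec_mulVec, nonsing_inv_mul _ hN.isUnit, one_mulVec]
    rfl
  simp only [gaussWeight, h1, h2, one_mulVec]

theorem integrable_gaussWeight (hσ : 0 < σ) (hA : A.PosDef) (w : Fin d → ℂ) :
    Integrable (gaussWeight σ A w) := by
  obtain ⟨N, rfl, hN⟩ := hA.exists_eq_transpose_mul_self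
  have hb : 0 < (1 / (4 * (σ : ℂ))).re := by
    rw [show 1 / (4 * (σ : ℂ)) = ((1 / (4 * σ) : ℝ) : ℂ) by push_cast; rfl, Complex.ofReal_re]
    positivity
  have h := GaussianFourier.integrable_cexp_neg_mul_sum_add hb (w ᵥ* (N⁻¹).map Complex.ofReal)
  rw [← gaussWeight_one] at h
  exact (integrable_comp_mulVec hN h).congr
    (.of_forall fun t => (gaussWeight_transpose_mul_self N hN w t).symm)

/-- The Gaussian integral with complex drift `c • a`. -/
theorem integral_gaussWeight (hσ : 0 < σ) (hA : A.PosDef) (c : ℂ) (a : Fin d → ℝ) :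
    ∫ t, gaussWeight σ A (fun i => c * (a i : ℂ)) t =
      (((4 * π * σ) ^ ((d : ℝ) / 2) * A.det ^ (-(1 : ℝ) / 2) : ℝ) : ℂ) *
        Complex.exp (σ * c ^ 2 * ((a ⬝ᵥ (A⁻¹ *ᵥ a) : ℝ) : ℂ)) := by
  have hdet := hA.det_pos
  obtain ⟨N, rfl, hN⟩ := hA.exists_eq_transpose_mul_self
  have hb : 0 < (1 / (4 * (σ : ℂ))).re := by
    rw [show 1 / (4 * (σ : ℂ)) = ((1 / (4 * σ) : ℝ) : ℂ) by push_cast; rfl, Complex.ofReal_re]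
    positivity
  have hσ' : (σ : ℂ) ≠ 0 := by exact_mod_cast hσ.ne'
  rw [(integral_congr_ae (.of_forall (gaussWeight_transpose_mul_self N hN _))).trans
    (integral_comp_mulVec hN _), gaussWeight_one,
    GaussianFourier.integral_cexp_neg_mul_sum_add hb]
  have hpow : ((π : ℂ) / (1 / (4 * (σ : ℂ)))) ^ ((Fintype.card (Fin d) : ℂ) / 2) =
      (((4 * π * σ) ^ ((d : ℝ) / 2) : ℝ) : ℂ) := by
    rw [Complex.ofReal_cpow (by positivity), Fintype.card_fin]
    push_cast
    congr 1
    field_simp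
  have hdet' : (Nᵀ * N).det ^ (-(1 : ℝ) / 2) = |N.det|⁻¹ := by
    rw [det_mul, det_transpose, ← sq, ← sq_abs, ← Real.rpow_natCast, ← Real.rpow_mul (abs_nonneg _)]
    norm_num [Real.rpow_neg_one]
  have hvec : ∀ i, ((fun i => c * (a i : ℂ)) ᵥ* (N⁻¹).map Complex.ofReal) i =
      c * ((a ᵥ* N⁻¹) i : ℂ) := by
    intro i
    simp only [vecMul, dotProduct, map_apply]
    push_cast
    rw [Finset.mul_sum]
    exact Finset.sum_congr rfl fun j _ => by ring
  have hquad : a ⬝ᵥ ((Nᵀ * N)⁻¹ *ᵥ a) = ∑ i, (a ᵥ* N⁻¹) i ^ 2 := by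
    rw [Matrix.mul_inv_rev, ← mulVec_mulVec, dotProduct_mulVec, ← transpose_nonsing_inv,
      mulVec_transpose]
    simp [dotProduct, sq]
  rw [hpow, hdet', hquad]
  simp_rw [hvec, mul_pow]
  rw [← Finset.mul_sum]
  push_cast
  rw [show (c ^ 2 * ∑ i, ((a ᵥ* N⁻¹) i : ℂ) ^ 2) / (4 * (1 / (4 * (σ : ℂ)))) =
    σ * c ^ 2 * ∑ i, ((a ᵥ* N⁻¹) i : ℂ) ^ 2 by field_simp]
  ring

/-- Integrability of `f` against all Gaussian weights with covariance `2σA⁻¹`. -/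
def GaussIntegrable (σ : ℝ) (A : Matrix (Fin d) (Fin d) ℝ) (f : (Fin d → ℝ) → ℂ) : Prop :=
  ∀ w, Integrable (fun t => f t * gaussWeight σ A w t)

/-- Multiplication by a linear form preserves integrability against all Gaussian weights. -/
theorem GaussIntegrable.dotProduct_mul {f : (Fin d → ℝ) → ℂ}
    (hf : GaussIntegrable σ A f) (u : Fin d → ℝ) :
    GaussIntegrable σ A (fun t => ((t ⬝ᵥ u : ℝ) : ℂ) * f t) := by
  intro w
  have hu : Continuous (fun t : Fin d → ℝ => ((t ⬝ᵥ u : ℝ) : ℂ)) :=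
    Complex.continuous_ofReal.comp (continuous_id.dotProduct continuous_const)
  have hshift : ∀ (s : ℝ) (t : Fin d → ℝ), gaussWeight σ A (fun i => w i + s * u i) t =
      ((Real.exp (s * (t ⬝ᵥ u)) : ℝ) : ℂ) * gaussWeight σ A w t := by
    intro s t
    simp only [gaussWeight, dotProduct]
    push_cast
    rw [← Complex.exp_add]
    simp_rw [add_mul, Finset.sum_add_distrib, Finset.mul_sum]
    rw [Finset.sum_congr rfl fun i _ => show (s : ℂ) * u i * t i = s * (t i * u i) by ring]
    congr 1
    ring
  refine (((hf (fun i => w i + (1 : ℝ) * u i)).norm).add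
    ((hf (fun i => w i + (-1 : ℝ) * u i)).norm)).mono' ?_ (.of_forall fun t => ?_)
  · simp_rw [mul_assoc]
    exact hu.aestronglyMeasurable.mul (hf w).aestronglyMeasurable
  · simp only [Pi.add_apply, hshift, norm_mul, Complex.norm_real, Real.norm_eq_abs, Real.abs_exp]
    have h : |t ⬝ᵥ u| ≤ Real.exp (1 * (t ⬝ᵥ u)) + Real.exp (-1 * (t ⬝ᵥ u)) := by
      have h1 := Real.add_one_le_exp (t ⬝ᵥ u)
      have h2 := Real.add_one_le_exp (-(t ⬝ᵥ u))
      have h3 := Real.exp_pos (t ⬝ᵥ u)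
      have h4 := Real.exp_pos (-(t ⬝ᵥ u))
      rw [one_mul, neg_one_mul, abs_le]
      constructor <;> linarith
    nlinarith [mul_le_mul_of_nonneg_right h
      (mul_nonneg (norm_nonneg (f t)) (norm_nonneg (gaussWeight σ A w t)))]

theorem hasLineDerivAt_dotProduct (u t v : Fin d → ℝ) :
    HasLineDerivAt ℝ (fun t : Fin d → ℝ => ((t ⬝ᵥ u : ℝ) : ℂ)) ((v ⬝ᵥ u : ℝ) : ℂ) t v := by
  unfold HasLineDerivAt
  simp only [add_dotProduct, smul_dotProduct, smul_eq_mul]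
  apply HasDerivAt.ofReal_comp
  simpa using ((hasDerivAt_id (0 : ℝ)).mul_const (v ⬝ᵥ u)).const_add (t ⬝ᵥ u)

theorem hasLineDerivAt_gaussWeight (hA : A.PosDef) (w : Fin d → ℂ) (t u : Fin d → ℝ) :
    HasLineDerivAt ℝ (gaussWeight σ A w)
      ((∑ i, w i * ((A⁻¹ *ᵥ u) i : ℂ) - ((t ⬝ᵥ u : ℝ) : ℂ) / (2 * (σ : ℂ))) *
        gaussWeight σ A w t) t (A⁻¹ *ᵥ u) := by
  have hdet : IsUnit A.det := hA.det_pos.ne'.isUnit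
  have hsymm : Aᵀ = A := by simpa using hA.isHermitian.eq
  set v := A⁻¹ *ᵥ u with hv
  have hAv : A *ᵥ v = u := by rw [hv, mulVec_mulVec, mul_nonsing_inv _ hdet, one_mulVec]
  have hvA : v ⬝ᵥ (A *ᵥ t) = t ⬝ᵥ u := by
    rw [dotProduct_mulVec, ← mulVec_transpose, hsymm, hAv, dotProduct_comm]
  have hlin : HasDerivAt (fun s : ℝ => ∑ i, w i * (((t + s • v) i : ℝ) : ℂ))
      (∑ i, w i * (v i : ℂ)) 0 := by
    refine HasDerivAt.fun_sum fun i _ => HasDerivAt.const_mul _ (HasDerivAt.ofReal_comp ?_)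
    simpa using ((hasDerivAt_id (0 : ℝ)).mul_const (v i)).const_add (t i)
  have hquad : HasDerivAt (fun s : ℝ => (t + s • v) ⬝ᵥ (A *ᵥ (t + s • v)))
      (2 * (t ⬝ᵥ u)) 0 := by
    have heq : (fun s : ℝ => (t + s • v) ⬝ᵥ (A *ᵥ (t + s • v))) =
        fun s => t ⬝ᵥ (A *ᵥ t) + s * (2 * (t ⬝ᵥ u)) + s ^ 2 * (v ⬝ᵥ u) := by
      ext s
      simp only [mulVec_add, mulVec_smul, hAv, add_dotProduct, dotProduct_add, smul_dotProduct,
        dotProduct_smul, smul_eq_mul, hvA]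
      ring
    rw [heq]
    simpa using (((hasDerivAt_id (0 : ℝ)).mul_const (2 * (t ⬝ᵥ u))).const_add
      (t ⬝ᵥ (A *ᵥ t))).fun_add (((hasDerivAt_id (0 : ℝ)).fun_pow 2).mul_const (v ⬝ᵥ u))
  have h := (hlin.fun_sub (hquad.ofReal_comp.div_const (4 * (σ : ℂ)))).cexp
  unfold HasLineDerivAt gaussWeight
  convert! h using 1
  simp only [zero_smul, add_zero]
  push_cast
  rw [mul_comm]
  congr 1
  ring

/-- Gaussian integration by parts (Stein's identity) in the direction `A⁻¹u`. -/
theorem integral_dotProduct_mul_gaussWeight (hσ : 0 < σ) (hA : A.PosDef)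
    {f f' : (Fin d → ℝ) → ℂ} (w : Fin d → ℂ) (u : Fin d → ℝ)
    (hf : GaussIntegrable σ A f) (hf' : GaussIntegrable σ A f')
    (hderiv : ∀ t, HasLineDerivAt ℝ f (f' t) t (A⁻¹ *ᵥ u)) :
    ∫ t, ((t ⬝ᵥ u : ℝ) : ℂ) * f t * gaussWeight σ A w t =
      2 * σ * ((∑ i, w i * ((A⁻¹ *ᵥ u) i : ℂ)) * ∫ t, f t * gaussWeight σ A w t) +
        2 * σ * ∫ t, f' t * gaussWeight σ A w t := by
  have hσ' : (σ : ℂ) ≠ 0 := by exact_mod_cast hσ.ne'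
  have hlin := hf.dotProduct_mul u w
  set c := ∑ i, w i * ((A⁻¹ *ᵥ u) i : ℂ)
  have hsplit : (fun t => f t * ((c - ((t ⬝ᵥ u : ℝ) : ℂ) / (2 * (σ : ℂ))) *
      gaussWeight σ A w t)) = fun t => c * (f t * gaussWeight σ A w t) -
        (2 * (σ : ℂ))⁻¹ * (((t ⬝ᵥ u : ℝ) : ℂ) * f t * gaussWeight σ A w t) := by
    ext t
    ring
  have key := integral_bilinear_hasLineDerivAt_right_eq_neg_left_of_integrable (μ := volume)
    (B := ContinuousLinearMap.mul ℝ ℂ) (f := f) (f' := f') (g := gaussWeight σ A w)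
    (g' := fun t => (c - ((t ⬝ᵥ u : ℝ) : ℂ) / (2 * (σ : ℂ))) * gaussWeight σ A w t)
    (v := A⁻¹ *ᵥ u) (hf' w)
    (by
      simp only [ContinuousLinearMap.mul_apply']
      rw [hsplit]
      exact ((hf w).const_mul c).sub (hlin.const_mul _))
    (hf w) (fun t _ => hderiv t) (fun t _ => hasLineDerivAt_gaussWeight hA w t u)
  simp only [ContinuousLinearMap.mul_apply'] at key
  rw [hsplit, integral_sub ((hf w).const_mul c) (hlin.const_mul _), integral_const_mul,
    integral_const_mul] at key
  field_simp at key
  linear_combination -key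

namespace GaussIntegrable

theorem const (hσ : 0 < σ) (hA : A.PosDef) (c : ℂ) : GaussIntegrable σ A (fun _ => c) :=
  fun w => (integrable_gaussWeight hσ hA w).const_mul c

theorem add {f g : (Fin d → ℝ) → ℂ} (hf : GaussIntegrable σ A f) (hg : GaussIntegrable σ A g) :
    GaussIntegrable σ A (fun t => f t + g t) := fun w => by
  simp only [add_mul]
  exact (hf w).add (hg w)

theorem const_mul {f : (Fin d → ℝ) → ℂ} (hf : GaussIntegrable σ A f) (c : ℂ) :
    GaussIntegrable σ A (fun t => c * f t) := fun w => by
  simpa only [mul_assoc] using (hf w).const_mul c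

theorem sum {ι : Type*} (s : Finset ι) {f : ι → (Fin d → ℝ) → ℂ}
    (hf : ∀ i ∈ s, GaussIntegrable σ A (f i)) :
    GaussIntegrable σ A (fun t => ∑ i ∈ s, f i t) := fun w => by
  simpa only [Finset.sum_mul] using integrable_finsetSum s fun i hi => hf i hi w

theorem congr {f g : (Fin d → ℝ) → ℂ} (hf : GaussIntegrable σ A f) (h : ∀ t, f t = g t) :
    GaussIntegrable σ A g := (funext h : f = g) ▸ hf

end GaussIntegrable

theorem quadraticForm_mul_eq_sum (B : Matrix (Fin d) (Fin d) ℝ) (z : ℂ) (t : Fin d → ℝ) :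
    ((t ⬝ᵥ (B *ᵥ t) : ℝ) : ℂ) * z = ∑ i, ∑ j, (B i j : ℂ) *
      (((t ⬝ᵥ Pi.single i 1 : ℝ) : ℂ) * (((t ⬝ᵥ Pi.single j 1 : ℝ) : ℂ) * z)) := by
  simp only [dotProduct_single, mul_one]
  simp only [dotProduct, mulVec, Finset.mul_sum, Complex.ofReal_sum, Complex.ofReal_mul,
    Finset.sum_mul]
  exact Finset.sum_congr rfl fun i _ => Finset.sum_congr rfl fun j _ => by ring

theorem GaussIntegrable.quadraticForm_mul {f : (Fin d → ℝ) → ℂ} (hf : GaussIntegrable σ A f)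
    (B : Matrix (Fin d) (Fin d) ℝ) :
    GaussIntegrable σ A (fun t => ((t ⬝ᵥ (B *ᵥ t) : ℝ) : ℂ) * f t) :=
  (GaussIntegrable.sum _ fun i _ => GaussIntegrable.sum _ fun j _ =>
    ((hf.dotProduct_mul (Pi.single j 1)).dotProduct_mul (Pi.single i 1)).const_mul (B i j : ℂ)).congr
      fun t => (quadraticForm_mul_eq_sum B (f t) t).symm

theorem integral_quadraticForm_mul_eq_sum {f : (Fin d → ℝ) → ℂ} (hf : GaussIntegrable σ A f)
    (B : Matrix (Fin d) (Fin d) ℝ) (w : Fin d → ℂ) :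
    ∫ t, ((t ⬝ᵥ (B *ᵥ t) : ℝ) : ℂ) * f t * gaussWeight σ A w t =
      ∑ i, ∑ j, (B i j : ℂ) * ∫ t, ((t ⬝ᵥ Pi.single i 1 : ℝ) : ℂ) *
        (((t ⬝ᵥ Pi.single j 1 : ℝ) : ℂ) * f t) * gaussWeight σ A w t := by
  have hint : ∀ i j, Integrable (fun t => (B i j : ℂ) * (((t ⬝ᵥ Pi.single i 1 : ℝ) : ℂ) *
      (((t ⬝ᵥ Pi.single j 1 : ℝ) : ℂ) * f t)) * gaussWeight σ A w t) := fun i j =>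
    ((hf.dotProduct_mul (Pi.single j 1)).dotProduct_mul (Pi.single i 1)).const_mul (B i j : ℂ) w
  simp_rw [quadraticForm_mul_eq_sum, Finset.sum_mul]
  rw [integral_finsetSum _ fun i _ => integrable_finsetSum _ fun j _ => hint i j]
  refine Finset.sum_congr rfl fun i _ => ?_
  rw [integral_finsetSum _ fun j _ => hint i j]
  refine Finset.sum_congr rfl fun j _ => ?_
  rw [← integral_const_mul]
  simp_rw [mul_assoc]

theorem sum_smul_mul_inv_mulVec (A : Matrix (Fin d) (Fin d) ℝ) (c : ℂ) (a u : Fin d → ℝ) :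
    ∑ i, c * (a i : ℂ) * ((A⁻¹ *ᵥ u) i : ℂ) = c * ((a ⬝ᵥ (A⁻¹ *ᵥ u) : ℝ) : ℂ) := by
  simp only [dotProduct, Complex.ofReal_sum, Complex.ofReal_mul, Finset.mul_sum, mul_assoc]

theorem HasLineDerivAt.dotProduct_mul {f : (Fin d → ℝ) → ℂ} {f' : ℂ} {t v : Fin d → ℝ}
    (hf : HasLineDerivAt ℝ f f' t v) (u : Fin d → ℝ) :
    HasLineDerivAt ℝ (fun t => ((t ⬝ᵥ u : ℝ) : ℂ) * f t)
      (((v ⬝ᵥ u : ℝ) : ℂ) * f t + ((t ⬝ᵥ u : ℝ) : ℂ) * f') t v := by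
  have h := HasDerivAt.fun_mul (hasLineDerivAt_dotProduct u t v) hf
  simpa only [HasLineDerivAt, zero_smul, add_zero] using h

theorem hasLineDerivAt_quadraticForm {B : Matrix (Fin d) (Fin d) ℝ} (hB : B.IsSymm)
    (t v : Fin d → ℝ) :
    HasLineDerivAt ℝ (fun t : Fin d → ℝ => ((t ⬝ᵥ (B *ᵥ t) : ℝ) : ℂ))
      (2 * ((t ⬝ᵥ (B *ᵥ v) : ℝ) : ℂ)) t v := by
  have hvt : v ⬝ᵥ (B *ᵥ t) = t ⬝ᵥ (B *ᵥ v) := by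
    rw [dotProduct_mulVec, ← mulVec_transpose, hB.eq, dotProduct_comm]
  have heq : (fun s : ℝ => (t + s • v) ⬝ᵥ (B *ᵥ (t + s • v))) =
      fun s => t ⬝ᵥ (B *ᵥ t) + s * (2 * (t ⬝ᵥ (B *ᵥ v))) + s ^ 2 * (v ⬝ᵥ (B *ᵥ v)) := by
    ext s
    simp only [mulVec_add, mulVec_smul, add_dotProduct, dotProduct_add, smul_dotProduct,
      dotProduct_smul, smul_eq_mul, hvt]
    ring
  have h : HasDerivAt (fun s : ℝ => (t + s • v) ⬝ᵥ (B *ᵥ (t + s • v)))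
      (2 * (t ⬝ᵥ (B *ᵥ v))) 0 := by
    rw [heq]
    simpa using (((hasDerivAt_id (0 : ℝ)).mul_const (2 * (t ⬝ᵥ (B *ᵥ v)))).const_add
      (t ⬝ᵥ (B *ᵥ t))).fun_add (((hasDerivAt_id (0 : ℝ)).fun_pow 2).mul_const (v ⬝ᵥ (B *ᵥ v)))
  simpa [HasLineDerivAt] using h.ofReal_comp

theorem integral_dotProduct_gaussWeight (hσ : 0 < σ) (hA : A.PosDef) (w : Fin d → ℂ)
    (u : Fin d → ℝ) :
    ∫ t, ((t ⬝ᵥ u : ℝ) : ℂ) * gaussWeight σ A w t =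
      2 * σ * (∑ i, w i * ((A⁻¹ *ᵥ u) i : ℂ)) * ∫ t, gaussWeight σ A w t := by
  have h := integral_dotProduct_mul_gaussWeight hσ hA w u (.const hσ hA 1) (.const hσ hA 0)
    fun _ => hasDerivAt_const _ _
  simpa [mul_assoc] using h

theorem integral_dotProduct_mul_dotProduct_gaussWeight (hσ : 0 < σ) (hA : A.PosDef)
    (w : Fin d → ℂ) (u v : Fin d → ℝ) :
    ∫ t, ((t ⬝ᵥ u : ℝ) : ℂ) * ((t ⬝ᵥ v : ℝ) : ℂ) * gaussWeight σ A w t =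
      (4 * σ ^ 2 * (∑ i, w i * ((A⁻¹ *ᵥ u) i : ℂ)) * (∑ i, w i * ((A⁻¹ *ᵥ v) i : ℂ)) +
        2 * σ * (((A⁻¹ *ᵥ u) ⬝ᵥ v : ℝ) : ℂ)) * ∫ t, gaussWeight σ A w t := by
  have hlin : GaussIntegrable σ A (fun t => ((t ⬝ᵥ v : ℝ) : ℂ)) :=
    ((GaussIntegrable.const hσ hA 1).dotProduct_mul v).congr fun t => mul_one _
  rw [integral_dotProduct_mul_gaussWeight hσ hA w u hlin (.const hσ hA _)
    fun t => hasLineDerivAt_dotProduct v t _, integral_dotProduct_gaussWeight hσ hA,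
    integral_const_mul]
  ring

theorem trace_mul_inv_eq_sum (A B : Matrix (Fin d) (Fin d) ℝ) :
    (((B * A⁻¹).trace : ℝ) : ℂ) = ∑ i, ∑ j, (B i j : ℂ) *
      (((A⁻¹ *ᵥ Pi.single i 1) ⬝ᵥ Pi.single j 1 : ℝ) : ℂ) := by
  simp [trace, mul_apply]

theorem trace_mul_mul_mul_eq_sum (B C P : Matrix (Fin d) (Fin d) ℝ) (hP : P.IsSymm) :
    (((B * P * C * P).trace : ℝ) : ℂ) = ∑ i, ∑ j, (B i j : ℂ) *
      (((P *ᵥ Pi.single j 1) ⬝ᵥ (C *ᵥ (P *ᵥ Pi.single i 1)) : ℝ) : ℂ) := by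
  have h : ∀ i j, (P *ᵥ Pi.single j 1) ⬝ᵥ (C *ᵥ (P *ᵥ Pi.single i 1)) = (P * C * P) j i := by
    intro i j
    rw [dotProduct_comm, dotProduct_mulVec, ← mulVec_transpose, hP.eq, mulVec_mulVec,
      mulVec_mulVec, Matrix.mul_assoc]
    simp
  simp_rw [h]
  rw [Matrix.mul_assoc B, Matrix.mul_assoc B]
  simp [trace, mul_apply (M := B)]

/-- The second moment of a quadratic form under a Gaussian weight with drift `c • a`. -/
theorem integral_quadraticForm_gaussWeight (hσ : 0 < σ) (hA : A.PosDef) (c : ℂ) (a : Fin d → ℝ)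
    (B : Matrix (Fin d) (Fin d) ℝ) :
    ∫ t, ((t ⬝ᵥ (B *ᵥ t) : ℝ) : ℂ) * gaussWeight σ A (fun i => c * (a i : ℂ)) t =
      (4 * σ ^ 2 * c ^ 2 * (((A⁻¹ *ᵥ a) ⬝ᵥ (B *ᵥ (A⁻¹ *ᵥ a)) : ℝ) : ℂ) +
        2 * σ * (((B * A⁻¹).trace : ℝ) : ℂ)) *
          ∫ t, gaussWeight σ A (fun i => c * (a i : ℂ)) t := by
  have hsymm : (A⁻¹)ᵀ = A⁻¹ := by simpa using hA.inv.isHermitian.eq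
  have h := integral_quadraticForm_mul_eq_sum (GaussIntegrable.const hσ hA 1) B
    (fun i => c * (a i : ℂ))
  simp only [mul_one] at h
  have hlin : ∀ i, a ⬝ᵥ (A⁻¹ *ᵥ Pi.single i 1) = (A⁻¹ *ᵥ a) i := by
    intro i
    rw [dotProduct_mulVec, ← mulVec_transpose, hsymm, dotProduct_single_one]
  have hquad : (((A⁻¹ *ᵥ a) ⬝ᵥ (B *ᵥ (A⁻¹ *ᵥ a)) : ℝ) : ℂ) =
      ∑ i, ∑ j, (B i j : ℂ) * (((A⁻¹ *ᵥ a) i : ℂ) * ((A⁻¹ *ᵥ a) j : ℂ)) := by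
    simpa using quadraticForm_mul_eq_sum B 1 (A⁻¹ *ᵥ a)
  rw [h, hquad, trace_mul_inv_eq_sum]
  simp_rw [integral_dotProduct_mul_dotProduct_gaussWeight hσ hA, sum_smul_mul_inv_mulVec, hlin]
  simp only [Finset.mul_sum, ← Finset.sum_add_distrib, Finset.sum_mul]
  exact Finset.sum_congr rfl fun i _ => Finset.sum_congr rfl fun j _ => by ring

theorem integral_dotProduct_mul_quadraticForm_gaussWeight (hσ : 0 < σ) (hA : A.PosDef)
    {B : Matrix (Fin d) (Fin d) ℝ} (hB : B.IsSymm) (u : Fin d → ℝ) :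
    ∫ t, ((t ⬝ᵥ u : ℝ) : ℂ) * ((t ⬝ᵥ (B *ᵥ t) : ℝ) : ℂ) * gaussWeight σ A 0 t = 0 := by
  have hq : GaussIntegrable σ A (fun t => ((t ⬝ᵥ (B *ᵥ t) : ℝ) : ℂ)) :=
    ((GaussIntegrable.const hσ hA 1).quadraticForm_mul B).congr fun t => mul_one _
  have hlin : ∀ v, GaussIntegrable σ A (fun t => ((t ⬝ᵥ v : ℝ) : ℂ)) := fun v =>
    ((GaussIntegrable.const hσ hA 1).dotProduct_mul v).congr fun t => mul_one _
  rw [integral_dotProduct_mul_gaussWeight hσ hA 0 u hq ((hlin _).const_mul 2)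
    fun t => hasLineDerivAt_quadraticForm hB t _]
  simp_rw [mul_assoc]
  rw [integral_const_mul, integral_dotProduct_gaussWeight hσ hA]
  simp

/-- The fourth moment of a centred Gaussian weight (Isserlis' formula for two quadratic forms). -/
theorem integral_quadraticForm_mul_quadraticForm_gaussWeight (hσ : 0 < σ) (hA : A.PosDef)
    (B : Matrix (Fin d) (Fin d) ℝ) {C : Matrix (Fin d) (Fin d) ℝ} (hC : C.IsSymm) :
    ∫ t, ((t ⬝ᵥ (B *ᵥ t) : ℝ) : ℂ) * ((t ⬝ᵥ (C *ᵥ t) : ℝ) : ℂ) * gaussWeight σ A 0 t =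
      4 * σ ^ 2 * ((((B * A⁻¹).trace : ℝ) : ℂ) * (((C * A⁻¹).trace : ℝ) : ℂ) +
        2 * (((B * A⁻¹ * C * A⁻¹).trace : ℝ) : ℂ)) * ∫ t, gaussWeight σ A 0 t := by
  have hsymm : (A⁻¹).IsSymm :=
    (conjTranspose_eq_transpose_of_trivial _).symm.trans hA.inv.isHermitian.eq
  have hq : GaussIntegrable σ A (fun t => ((t ⬝ᵥ (C *ᵥ t) : ℝ) : ℂ)) :=
    ((GaussIntegrable.const hσ hA 1).quadraticForm_mul C).congr fun t => mul_one _
  have hlin : ∀ v, GaussIntegrable σ A (fun t => ((t ⬝ᵥ v : ℝ) : ℂ)) := fun v =>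
    ((GaussIntegrable.const hσ hA 1).dotProduct_mul v).congr fun t => mul_one _
  have hC2 : ∫ t, ((t ⬝ᵥ (C *ᵥ t) : ℝ) : ℂ) * gaussWeight σ A 0 t =
      2 * σ * (((C * A⁻¹).trace : ℝ) : ℂ) * ∫ t, gaussWeight σ A 0 t := by
    have h := integral_quadraticForm_gaussWeight hσ hA 0 0 C
    have h0 : (fun i => (0 : ℂ) * (((0 : Fin d → ℝ) i : ℝ) : ℂ)) = 0 := by ext; simp
    rw [h0] at h
    simpa using h
  have hmom : ∀ u v, ∫ t, ((t ⬝ᵥ u : ℝ) : ℂ) * (((t ⬝ᵥ v : ℝ) : ℂ) *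
      ((t ⬝ᵥ (C *ᵥ t) : ℝ) : ℂ)) * gaussWeight σ A 0 t =
      4 * σ ^ 2 * ((((A⁻¹ *ᵥ u) ⬝ᵥ v : ℝ) : ℂ) * (((C * A⁻¹).trace : ℝ) : ℂ) +
        2 * (((A⁻¹ *ᵥ v) ⬝ᵥ (C *ᵥ (A⁻¹ *ᵥ u)) : ℝ) : ℂ)) * ∫ t, gaussWeight σ A 0 t := by
    intro u v
    have h1 := hq.const_mul (((A⁻¹ *ᵥ u) ⬝ᵥ v : ℝ) : ℂ)
    have h2 := ((hlin (C *ᵥ (A⁻¹ *ᵥ u))).const_mul 2).dotProduct_mul v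
    rw [integral_dotProduct_mul_gaussWeight hσ hA 0 u (hq.dotProduct_mul v) (h1.add h2)
      fun t => (hasLineDerivAt_quadraticForm hC t _).dotProduct_mul v]
    simp_rw [add_mul]
    rw [integral_add (h1 0) (h2 0)]
    have h3 : ∀ t : Fin d → ℝ, ((t ⬝ᵥ v : ℝ) : ℂ) * (2 * ((t ⬝ᵥ (C *ᵥ (A⁻¹ *ᵥ u)) : ℝ) : ℂ)) *
        gaussWeight σ A 0 t = 2 * (((t ⬝ᵥ v : ℝ) : ℂ) *
          ((t ⬝ᵥ (C *ᵥ (A⁻¹ *ᵥ u)) : ℝ) : ℂ) * gaussWeight σ A 0 t) := fun t => by ring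
    simp_rw [h3]
    rw [integral_const_mul, integral_dotProduct_mul_dotProduct_gaussWeight hσ hA]
    simp_rw [mul_assoc]
    rw [integral_const_mul, hC2]
    simp only [Pi.zero_apply, zero_mul, Finset.sum_const_zero]
    ring
  rw [integral_quadraticForm_mul_eq_sum hq, trace_mul_inv_eq_sum,
    trace_mul_mul_mul_eq_sum B C _ hsymm]
  simp_rw [hmom]
  simp only [Finset.mul_sum, ← Finset.sum_add_distrib, Finset.sum_mul]
  exact Finset.sum_congr rfl fun i _ => Finset.sum_congr rfl fun j _ => by ring

theorem gaussIntegrable_quadraticPolynomial (hσ : 0 < σ) (hA : A.PosDef) (β γ : ℂ)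
    (b : Fin d → ℝ) (B : Matrix (Fin d) (Fin d) ℝ) :
    GaussIntegrable σ A
      (fun t => 1 + β * ((t ⬝ᵥ b : ℝ) : ℂ) + γ * ((t ⬝ᵥ (B *ᵥ t) : ℝ) : ℂ)) := by
  have h := GaussIntegrable.const hσ hA 1
  refine ((h.add ((h.dotProduct_mul b).const_mul β)).add
    ((h.quadraticForm_mul B).const_mul γ)).congr fun t => ?_
  simp only [mul_one]

theorem integral_quadraticPolynomial_gaussWeight (hσ : 0 < σ) (hA : A.PosDef) (c β γ : ℂ)
    (a b : Fin d → ℝ) (B : Matrix (Fin d) (Fin d) ℝ) :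
    ∫ t, (1 + β * ((t ⬝ᵥ b : ℝ) : ℂ) + γ * ((t ⬝ᵥ (B *ᵥ t) : ℝ) : ℂ)) *
        gaussWeight σ A (fun i => c * (a i : ℂ)) t =
      (1 + β * (2 * σ * c * ((a ⬝ᵥ (A⁻¹ *ᵥ b) : ℝ) : ℂ)) +
        γ * (4 * σ ^ 2 * c ^ 2 * (((A⁻¹ *ᵥ a) ⬝ᵥ (B *ᵥ (A⁻¹ *ᵥ a)) : ℝ) : ℂ) +
          2 * σ * (((B * A⁻¹).trace : ℝ) : ℂ))) *
        ∫ t, gaussWeight σ A (fun i => c * (a i : ℂ)) t := by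
  have h := GaussIntegrable.const hσ hA 1
  have hb := ((h.dotProduct_mul b).const_mul β) (fun i => c * (a i : ℂ))
  have hB := ((h.quadraticForm_mul B).const_mul γ) (fun i => c * (a i : ℂ))
  have h1 := integrable_gaussWeight hσ hA (fun i => c * (a i : ℂ))
  simp only [mul_one, mul_assoc] at hb hB
  simp_rw [add_mul, one_mul, mul_assoc]
  rw [integral_add (h1.fun_add hb) hB, integral_add h1 hb, integral_const_mul, integral_const_mul,
    integral_dotProduct_gaussWeight hσ hA, integral_quadraticForm_gaussWeight hσ hA,
    sum_smul_mul_inv_mulVec]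
  ring

theorem gaussIntegrable_quadraticPolynomial_mul (hσ : 0 < σ) (hA : A.PosDef) (α β γ δ : ℂ)
    (a b : Fin d → ℝ) (B C : Matrix (Fin d) (Fin d) ℝ) :
    GaussIntegrable σ A
      (fun t => (1 + α * ((t ⬝ᵥ a : ℝ) : ℂ) + γ * ((t ⬝ᵥ (B *ᵥ t) : ℝ) : ℂ)) *
        (1 + β * ((t ⬝ᵥ b : ℝ) : ℂ) + δ * ((t ⬝ᵥ (C *ᵥ t) : ℝ) : ℂ))) := by
  have h := gaussIntegrable_quadraticPolynomial hσ hA β δ b C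
  refine ((h.add ((h.dotProduct_mul a).const_mul α)).add
    ((h.quadraticForm_mul B).const_mul γ)).congr fun t => ?_
  ring

theorem integral_quadraticPolynomial_mul_gaussWeight (hσ : 0 < σ) (hA : A.PosDef)
    (α β γ δ : ℂ) (a b : Fin d → ℝ) {B C : Matrix (Fin d) (Fin d) ℝ} (hB : B.IsSymm)
    (hC : C.IsSymm) :
    ∫ t, (1 + α * ((t ⬝ᵥ a : ℝ) : ℂ) + γ * ((t ⬝ᵥ (B *ᵥ t) : ℝ) : ℂ)) *
        (1 + β * ((t ⬝ᵥ b : ℝ) : ℂ) + δ * ((t ⬝ᵥ (C *ᵥ t) : ℝ) : ℂ)) * gaussWeight σ A 0 t =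
      (1 + α * β * (2 * σ * ((a ⬝ᵥ (A⁻¹ *ᵥ b) : ℝ) : ℂ)) +
        γ * (2 * σ * (((B * A⁻¹).trace : ℝ) : ℂ)) + δ * (2 * σ * (((C * A⁻¹).trace : ℝ) : ℂ)) +
        γ * δ * (4 * σ ^ 2 * ((((B * A⁻¹).trace : ℝ) : ℂ) * (((C * A⁻¹).trace : ℝ) : ℂ) +
          2 * (((B * A⁻¹ * C * A⁻¹).trace : ℝ) : ℂ)))) * ∫ t, gaussWeight σ A 0 t := by
  have h := GaussIntegrable.const hσ hA 1
  have hlin : ∀ v, GaussIntegrable σ A (fun t => ((t ⬝ᵥ v : ℝ) : ℂ)) := fun v =>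
    (h.dotProduct_mul v).congr fun t => mul_one _
  have hquad : ∀ M : Matrix (Fin d) (Fin d) ℝ,
      GaussIntegrable σ A (fun t => ((t ⬝ᵥ (M *ᵥ t) : ℝ) : ℂ)) := fun M =>
    (h.quadraticForm_mul M).congr fun t => mul_one _
  have hP := gaussIntegrable_quadraticPolynomial hσ hA β δ b C 0
  have ha := ((hlin a).const_mul α) 0
  have hab := (((hlin b).dotProduct_mul a).const_mul (α * β)) 0
  have haC := (((hquad C).dotProduct_mul a).const_mul (α * δ)) 0
  have hBq := ((hquad B).const_mul γ) 0
  have hbB := (((hquad B).dotProduct_mul b).const_mul (γ * β)) 0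
  have hBC := (((hquad C).quadraticForm_mul B).const_mul (γ * δ)) 0
  have h0 : (fun i => (0 : ℂ) * (((0 : Fin d → ℝ) i : ℝ) : ℂ)) = 0 := by ext; simp
  have hPint := integral_quadraticPolynomial_gaussWeight hσ hA 0 β δ 0 b C
  have hBint := integral_quadraticForm_gaussWeight hσ hA 0 0 B
  rw [h0] at hPint hBint
  have hlin0 : ∫ t, ((t ⬝ᵥ a : ℝ) : ℂ) * gaussWeight σ A 0 t = 0 := by
    simp [integral_dotProduct_gaussWeight hσ hA]
  have hab_int := integral_dotProduct_mul_dotProduct_gaussWeight hσ hA 0 a b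
  have hsymm : (A⁻¹)ᵀ = A⁻¹ := by simpa using hA.inv.isHermitian.eq
  have hdot : (A⁻¹ *ᵥ a) ⬝ᵥ b = a ⬝ᵥ (A⁻¹ *ᵥ b) := by
    rw [dotProduct_mulVec a, ← mulVec_transpose, hsymm]
  simp_rw [mul_assoc] at ha hab haC hBq hbB hBC hBint hab_int
  have haC_int := integral_dotProduct_mul_quadraticForm_gaussWeight hσ hA hC a
  have hbB_int := integral_dotProduct_mul_quadraticForm_gaussWeight hσ hA hB b
  have hBC_int := integral_quadraticForm_mul_quadraticForm_gaussWeight hσ hA B hC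
  simp_rw [mul_assoc] at haC_int hbB_int hBC_int
  beta_reduce at hP
  have hexp : ∀ t : Fin d → ℝ, (1 + α * ((t ⬝ᵥ a : ℝ) : ℂ) + γ * ((t ⬝ᵥ (B *ᵥ t) : ℝ) : ℂ)) *
      (1 + β * ((t ⬝ᵥ b : ℝ) : ℂ) + δ * ((t ⬝ᵥ (C *ᵥ t) : ℝ) : ℂ)) * gaussWeight σ A 0 t =
      (1 + β * ((t ⬝ᵥ b : ℝ) : ℂ) + δ * ((t ⬝ᵥ (C *ᵥ t) : ℝ) : ℂ)) * gaussWeight σ A 0 t +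
      α * (((t ⬝ᵥ a : ℝ) : ℂ) * gaussWeight σ A 0 t) +
      α * (β * (((t ⬝ᵥ a : ℝ) : ℂ) * (((t ⬝ᵥ b : ℝ) : ℂ) * gaussWeight σ A 0 t))) +
      α * (δ * (((t ⬝ᵥ a : ℝ) : ℂ) * (((t ⬝ᵥ (C *ᵥ t) : ℝ) : ℂ) * gaussWeight σ A 0 t))) +
      γ * (((t ⬝ᵥ (B *ᵥ t) : ℝ) : ℂ) * gaussWeight σ A 0 t) +
      γ * (β * (((t ⬝ᵥ b : ℝ) : ℂ) * (((t ⬝ᵥ (B *ᵥ t) : ℝ) : ℂ) * gaussWeight σ A 0 t))) +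
      γ * (δ * (((t ⬝ᵥ (B *ᵥ t) : ℝ) : ℂ) *
        (((t ⬝ᵥ (C *ᵥ t) : ℝ) : ℂ) * gaussWeight σ A 0 t))) := fun t => by ring
  simp_rw [hexp]
  have h2 := hP.fun_add ha
  have h3 := h2.fun_add hab
  have h4 := h3.fun_add haC
  have h5 := h4.fun_add hBq
  have h6 := h5.fun_add hbB
  rw [integral_add h6 hBC, integral_add h5 hbB, integral_add h4 hBq, integral_add h3 haC,
    integral_add h2 hab, integral_add hP ha]
  simp only [integral_const_mul, hPint, hlin0, hab_int, haC_int, hBint, hbB_int, hBC_int, hdot,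
    Pi.zero_apply, zero_mul, Finset.sum_const_zero, Matrix.mul_assoc]
  ring

end GaussWeight

section Kernel

variable {d : ℕ} {σ : ℝ} {m₀ : Fin d → ℝ} {S : Matrix (Fin d) (Fin d) ℝ}

theorem posDef_Vm (hσ : 0 < σ) (hS : S.PosDef) : (Vm σ S).PosDef :=
  PosDef.one.add (hS.smul (by positivity))

theorem posDef_two_smul_Vm_sub_one (hσ : 0 < σ) (hS : S.PosDef) :
    ((2 : ℝ) • Vm σ S - 1).PosDef := by
  have h : (2 : ℝ) • Vm σ S - 1 = 1 + (4 * σ) • S := by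
    rw [Vm]
    module
  rw [h]
  exact PosDef.one.add (hS.smul (by positivity))

theorem isSymm_Bm (hS : S.PosDef) (x : Fin d → ℝ) : (Bm m₀ S x).IsSymm := by
  have h : Sᵀ = S := by simpa using hS.isHermitian.eq
  rw [IsSymm, Bm, transpose_sub, transpose_vecMulVec, h]

theorem Ff_mul_conj_Ff_mul_exp (σ : ℝ) (m₀ : Fin d → ℝ)
    (S : Matrix (Fin d) (Fin d) ℝ) (x y t : Fin d → ℝ) :
    Ff σ m₀ S x t * (starRingEnd ℂ) (Ff σ m₀ S y t) *
        Complex.exp (((t ⬝ᵥ t : ℝ) : ℂ) / (4 * (σ : ℂ))) =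
      ((((4 * π * σ) ^ (-(d : ℝ) / 2)) ^ 2 : ℝ) : ℂ) *
        (gaussWeight σ 1 (fun i => -Complex.I * (((x - y) i : ℝ) : ℂ)) t -
          (1 + Complex.I * ((t ⬝ᵥ (y - m₀) : ℝ) : ℂ) +
              (-1 / 2) * ((t ⬝ᵥ (Bm m₀ S y *ᵥ t) : ℝ) : ℂ)) *
            gaussWeight σ (Vm σ S) (fun i => -Complex.I * (((x - m₀) i : ℝ) : ℂ)) t -
          (1 + -Complex.I * ((t ⬝ᵥ (x - m₀) : ℝ) : ℂ) +
              (-1 / 2) * ((t ⬝ᵥ (Bm m₀ S x *ᵥ t) : ℝ) : ℂ)) *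
            gaussWeight σ (Vm σ S) (fun i => Complex.I * (((y - m₀) i : ℝ) : ℂ)) t +
          (1 + -Complex.I * ((t ⬝ᵥ (x - m₀) : ℝ) : ℂ) +
              (-1 / 2) * ((t ⬝ᵥ (Bm m₀ S x *ᵥ t) : ℝ) : ℂ)) *
            (1 + Complex.I * ((t ⬝ᵥ (y - m₀) : ℝ) : ℂ) +
              (-1 / 2) * ((t ⬝ᵥ (Bm m₀ S y *ᵥ t) : ℝ) : ℂ)) *
            gaussWeight σ ((2 : ℝ) • Vm σ S - 1) 0 t) := by
  have hlin : ∀ (c : ℂ) (u : Fin d → ℝ), ∑ i, c * (u i : ℂ) * (t i : ℂ) =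
      c * ((u ⬝ᵥ t : ℝ) : ℂ) := by
    intro c u
    simp only [dotProduct, Complex.ofReal_sum, Complex.ofReal_mul, Finset.mul_sum, mul_assoc]
  have hW : t ⬝ᵥ (((2 : ℝ) • Vm σ S - 1) *ᵥ t) = 2 * (t ⬝ᵥ (Vm σ S *ᵥ t)) - t ⬝ᵥ t := by
    rw [sub_mulVec, smul_mulVec, dotProduct_sub, dotProduct_smul, one_mulVec, smul_eq_mul]
  simp only [Ff, gaussWeight, hlin, hW, one_mulVec, Pi.zero_apply, zero_mul,
    Finset.sum_const_zero, sub_dotProduct]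
  simp only [map_mul, map_sub, map_one, map_div₀, map_neg, Complex.conj_ofReal, Complex.conj_I,
    ← Complex.exp_conj, map_ofNat]
  push_cast
  set T : ℂ := ((t ⬝ᵥ t : ℝ) : ℂ)
  set Q : ℂ := ((t ⬝ᵥ (Vm σ S *ᵥ t) : ℝ) : ℂ)
  set X : ℂ := ((x ⬝ᵥ t : ℝ) : ℂ)
  set Y : ℂ := ((y ⬝ᵥ t : ℝ) : ℂ)
  set M : ℂ := ((m₀ ⬝ᵥ t : ℝ) : ℂ)
  have e1 : Complex.exp (-Complex.I * (X - Y) - T / (4 * σ)) =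
      Complex.exp (-Complex.I * X - T / (4 * σ)) * Complex.exp (- -Complex.I * Y - T / (4 * σ)) *
        Complex.exp (T / (4 * σ)) := by
    rw [← Complex.exp_add, ← Complex.exp_add]; congr 1; ring
  have e2 : Complex.exp (-Complex.I * (X - M) - Q / (4 * σ)) =
      Complex.exp (-Complex.I * X - T / (4 * σ)) * Complex.exp (- -Complex.I * M - Q / (4 * σ)) *
        Complex.exp (T / (4 * σ)) := by
    rw [← Complex.exp_add, ← Complex.exp_add]; congr 1; ring
  have e3 : Complex.exp (Complex.I * (Y - M) - Q / (4 * σ)) =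
      Complex.exp (-Complex.I * M - Q / (4 * σ)) * Complex.exp (- -Complex.I * Y - T / (4 * σ)) *
        Complex.exp (T / (4 * σ)) := by
    rw [← Complex.exp_add, ← Complex.exp_add]; congr 1; ring
  have e4 : Complex.exp (0 - (2 * Q - T) / (4 * σ)) =
      Complex.exp (-Complex.I * M - Q / (4 * σ)) * Complex.exp (- -Complex.I * M - Q / (4 * σ)) *
        Complex.exp (T / (4 * σ)) := by
    rw [← Complex.exp_add, ← Complex.exp_add]; congr 1; ring
  rw [e1, e2, e3, e4]
  ring

theorem T2_eq (hσ : 0 < σ) (hS : S.PosDef) (x y : Fin d → ℝ) :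
    T2 σ m₀ S x y = (Vm σ S).det ^ (-(1 : ℝ) / 2) *
      Real.exp (-σ * ((x - m₀) ⬝ᵥ ((Vm σ S)⁻¹ *ᵥ (x - m₀)))) *
      (1 + 2 * σ * ((x - m₀) ⬝ᵥ ((Vm σ S)⁻¹ *ᵥ (y - m₀))) +
        2 * σ ^ 2 * (((Vm σ S)⁻¹ *ᵥ (x - m₀)) ⬝ᵥ
          (Bm m₀ S y *ᵥ ((Vm σ S)⁻¹ *ᵥ (x - m₀)))) -
        σ * (Bm m₀ S y * (Vm σ S)⁻¹).trace) := by
  have hsymm : ((Vm σ S)⁻¹)ᵀ = (Vm σ S)⁻¹ := by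
    simpa using (posDef_Vm hσ hS).inv.isHermitian.eq
  have hB := isSymm_Bm (m₀ := m₀) hS y
  have htr : ((Vm σ S)⁻¹ * ((2 * σ) • (Bm m₀ S x + S) * (Vm σ S)⁻¹ - 1) * Bm m₀ S y).trace =
      2 * σ * (((Vm σ S)⁻¹ *ᵥ (x - m₀)) ⬝ᵥ (Bm m₀ S y *ᵥ ((Vm σ S)⁻¹ *ᵥ (x - m₀)))) -
        (Bm m₀ S y * (Vm σ S)⁻¹).trace := by
    have h : Bm m₀ S x + S = vecMulVec (x - m₀) (x - m₀) := sub_add_cancel _ _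
    rw [h, Matrix.mul_sub, Matrix.sub_mul, trace_sub, Matrix.mul_one, trace_mul_comm (Vm σ S)⁻¹,
      Matrix.smul_mul, Matrix.mul_smul, Matrix.smul_mul, trace_smul, smul_eq_mul, ← Matrix.mul_assoc, mul_vecMulVec,
      vecMulVec_mul, vecMulVec_mul, trace_vecMulVec, ← mulVec_transpose, ← mulVec_transpose,
      hsymm, hB.eq]
  rw [T2, htr]
  ring

theorem integral_cross_term (hσ : 0 < σ) (hS : S.PosDef) {c β : ℂ} (hc : c ^ 2 = -1)
    (hβ : β * c = 1) (x y : Fin d → ℝ) :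
    ∫ t, (1 + β * ((t ⬝ᵥ (y - m₀) : ℝ) : ℂ) +
        (-1 / 2) * ((t ⬝ᵥ (Bm m₀ S y *ᵥ t) : ℝ) : ℂ)) *
        gaussWeight σ (Vm σ S) (fun i => c * (((x - m₀) i : ℝ) : ℂ)) t =
      (((4 * π * σ) ^ ((d : ℝ) / 2) * T2 σ m₀ S x y : ℝ) : ℂ) := by
  have hV := posDef_Vm hσ hS
  rw [integral_quadraticPolynomial_gaussWeight hσ hV, integral_gaussWeight hσ hV,
    T2_eq hσ hS, hc]
  simp only [Complex.ofReal_mul, Complex.ofReal_exp, Complex.ofReal_add, Complex.ofReal_sub,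
    Complex.ofReal_one, Complex.ofReal_ofNat, Complex.ofReal_pow, Complex.ofReal_neg, mul_neg_one]
  generalize Complex.exp _ = e
  generalize (((Vm σ S).det ^ (-(1 : ℝ) / 2) : ℝ) : ℂ) = q
  linear_combination (2 * σ * (((x - m₀) ⬝ᵥ ((Vm σ S)⁻¹ *ᵥ (y - m₀)) : ℝ) : ℂ) *
    (((4 * π * σ) ^ ((d : ℝ) / 2) : ℝ) : ℂ) * q * e) * hβ

theorem integral_quartic_term (hσ : 0 < σ) (hS : S.PosDef) (x y : Fin d → ℝ) :
    ∫ t, (1 + -Complex.I * ((t ⬝ᵥ (x - m₀) : ℝ) : ℂ) +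
        (-1 / 2) * ((t ⬝ᵥ (Bm m₀ S x *ᵥ t) : ℝ) : ℂ)) *
        (1 + Complex.I * ((t ⬝ᵥ (y - m₀) : ℝ) : ℂ) +
          (-1 / 2) * ((t ⬝ᵥ (Bm m₀ S y *ᵥ t) : ℝ) : ℂ)) *
        gaussWeight σ ((2 : ℝ) • Vm σ S - 1) 0 t =
      (((4 * π * σ) ^ ((d : ℝ) / 2) * T4 σ m₀ S x y : ℝ) : ℂ) := by
  have hW := posDef_two_smul_Vm_sub_one hσ hS
  have h0 : (fun i => (0 : ℂ) * (((0 : Fin d → ℝ) i : ℝ) : ℂ)) = 0 := by ext; simp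
  have hZ := integral_gaussWeight hσ hW 0 0
  have hsymm : (((2 : ℝ) • Vm σ S - 1)⁻¹)ᵀ = ((2 : ℝ) • Vm σ S - 1)⁻¹ := by
    simpa using hW.inv.isHermitian.eq
  rw [h0] at hZ
  rw [integral_quadraticPolynomial_mul_gaussWeight hσ hW _ _ _ _ _ _ (isSymm_Bm hS x)
    (isSymm_Bm hS y), hZ, T4, Matrix.sub_mul, Matrix.sub_mul, trace_sub, trace_sub,
    Matrix.smul_mul, trace_smul, vecMulVec_mul, trace_vecMulVec, ← mulVec_transpose, hsymm, smul_eq_mul,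
    neg_mul, Complex.I_mul_I]
  simp only [zero_dotProduct, Complex.ofReal_zero, mul_zero, Complex.exp_zero]
  push_cast
  ring

theorem integral_first_term (hσ : 0 < σ) (x y : Fin d → ℝ) :
    ∫ t, gaussWeight σ 1 (fun i => -Complex.I * (((x - y) i : ℝ) : ℂ)) t =
      (((4 * π * σ) ^ ((d : ℝ) / 2) * T1 σ x y : ℝ) : ℂ) := by
  rw [integral_gaussWeight hσ PosDef.one, T1]
  simp

end Kernel

/-- Weighted-`L²` inner product formula (Eq. (E47)):
`(4πσ)^{d/2} ∫ F_x(t) conj(F_y(t)) exp(‖t‖²/(4σ)) dt = K(x,y)`;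
in particular the integral is real. -/
theorem weighted_L2_inner_product {d : ℕ} (hd : 1 ≤ d) (σ : ℝ) (hσ : 0 < σ)
    (m₀ : Fin d → ℝ) (S : Matrix (Fin d) (Fin d) ℝ) (hS : S.PosDef)
    (x y : Fin d → ℝ) :
    (((4 * π * σ) ^ ((d : ℝ) / 2) : ℝ) : ℂ) *
      ∫ t : Fin d → ℝ, Ff σ m₀ S x t * (starRingEnd ℂ) (Ff σ m₀ S y t) *
        Complex.exp (((t ⬝ᵥ t : ℝ) : ℂ) / (4 * (σ : ℂ))) =
    ((Kf σ m₀ S x y : ℝ) : ℂ) := by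
  have hV := posDef_Vm hσ hS
  have hW := posDef_two_smul_Vm_sub_one hσ hS
  have h1 := integrable_gaussWeight hσ PosDef.one
    (fun i => -Complex.I * (((x - y) i : ℝ) : ℂ))
  have h2 := gaussIntegrable_quadraticPolynomial hσ hV Complex.I (-1 / 2) (y - m₀) (Bm m₀ S y)
    (fun i => -Complex.I * (((x - m₀) i : ℝ) : ℂ))
  have h3 := gaussIntegrable_quadraticPolynomial hσ hV (-Complex.I) (-1 / 2) (x - m₀)
    (Bm m₀ S x) (fun i => Complex.I * (((y - m₀) i : ℝ) : ℂ))
  have h4 := gaussIntegrable_quadraticPolynomial_mul hσ hW (-Complex.I) Complex.I (-1 / 2)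
    (-1 / 2) (x - m₀) (y - m₀) (Bm m₀ S x) (Bm m₀ S y) 0
  simp_rw [Ff_mul_conj_Ff_mul_exp]
  beta_reduce at h2 h3 h4
  have h12 := h1.sub' h2
  have h123 := h12.sub' h3
  rw [integral_const_mul, integral_add h123 h4, integral_sub h12 h3, integral_sub h1 h2, integral_first_term hσ,
    integral_cross_term hσ hS (by simp) (by simp),
    integral_cross_term hσ hS (by simp) (by simp), integral_quartic_term hσ hS]
  have hk : (4 * π * σ) ^ ((d : ℝ) / 2) * ((4 * π * σ) ^ (-(d : ℝ) / 2)) = 1 := by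
    rw [← Real.rpow_add (by positivity), neg_div, add_neg_cancel, Real.rpow_zero]
  set p := (4 * π * σ) ^ ((d : ℝ) / 2)
  set q := (4 * π * σ) ^ (-(d : ℝ) / 2)
  norm_cast
  rw [Kf, T3]
  linear_combination (p * q + 1) * (T1 σ x y - T2 σ m₀ S x y - T2 σ m₀ S y x + T4 σ m₀ S x y) * hk
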